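/- For every integer n ≥ 6, there exists a single layered Clifford+Z_N realization of the n-MCT gate that simultaneously has phase depth at most 4n − 6 and phase count at most 2n² + n − 16: there are an integer d ≤ 4n − 6, matrices C₀, …, C_d in the submonoid of 2^n × 2^n complex matrices generated by the Clifford gate embeddings H_i, S_i, S_i†, CNOT_{i,j}, and phase layers P₁, …, P_d on n qubits whose total number of non-identity tensor factors over all layers is at most 2n² + n − 16, with MCT_n = C₀ · P₁ · C₁ · ⋯ · P_d · C_d. -/

import Mathlib

/-!
Gates are represented as matrices indexed by `Bool` (single qubit, so a 2×2 matrix)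
or by `Fin n → Bool` (n qubits, so a 2^n × 2^n matrix). The basis index `true`
corresponds to the basis state |1⟩ and `false` to |0⟩.
-/

namespace MCT

/-- The Hadamard gate `H = (1/√2)·[[1,1],[1,−1]]`. -/
noncomputable def Hg : Matrix Bool Bool ℂ :=
  fun a b => (1 / (Real.sqrt 2 : ℂ)) * (if a && b then -1 else 1)

/-- The phase gate `Z_N = diag(1, exp(iπ/N))`. -/
noncomputable def Zg (N : ℕ) : Matrix Bool Bool ℂ :=
  fun a b => if a = b then (if a then Complex.exp (Real.pi * Complex.I / N) else 1) else 0

/-- The adjoint phase gate `Z_N† = diag(1, exp(−iπ/N))`. -/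
noncomputable def Zgd (N : ℕ) : Matrix Bool Bool ℂ :=
  fun a b => if a = b then (if a then Complex.exp (-(Real.pi * Complex.I) / N) else 1) else 0

/-- Embedding `G_i = I₂^{⊗(i−1)} ⊗ G ⊗ I₂^{⊗(n−i)}` of a single-qubit gate `G`
on qubit `i` of `n` qubits. -/
noncomputable def embed {n : ℕ} (G : Matrix Bool Bool ℂ) (i : Fin n) :
    Matrix (Fin n → Bool) (Fin n → Bool) ℂ :=
  fun x y => (if ∀ j, j ≠ i → x j = y j then 1 else 0) * G (x i) (y i)

/-- `CNOT_{i,j}`: the permutation matrix mapping the basis state `y` to the state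
with `y j` replaced by `y j ⊕ y i` (control `i`, target `j`). -/
def cnot {n : ℕ} (i j : Fin n) : Matrix (Fin n → Bool) (Fin n → Bool) ℂ :=
  fun x y => if (∀ k, k ≠ j → x k = y k) ∧ x j = xor (y j) (y i) then 1 else 0

/-- The function on basis states realized by the `n`-MCT gate: the last bit is
XORed with the product (conjunction) of the first `n−1` bits. -/
def mctFun (n : ℕ) (y : Fin n → Bool) : Fin n → Bool :=
  fun k => if (k : ℕ) = n - 1 then
      xor (y k) (decide (∀ j : Fin n, (j : ℕ) < n - 1 → y j = true))
    else y k

/-- The `n`-MCT matrix: the permutation matrix mapping basis state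
`|x₁…x_n⟩` to `|x₁…x_{n−1}, x_n ⊕ (x₁⋯x_{n−1})⟩`. -/
def mct (n : ℕ) : Matrix (Fin n → Bool) (Fin n → Bool) ℂ :=
  fun x y => if x = mctFun n y then 1 else 0

/-- The Clifford generators on `n` qubits: the embeddings `H_i`, `S_i = (Z₂)_i`,
`S_i† = (Z₂†)_i`, and `CNOT_{i,j}` for `i ≠ j`. -/
def cliffordGens (n : ℕ) : Set (Matrix (Fin n → Bool) (Fin n → Bool) ℂ) :=
  {M | (∃ i, M = embed Hg i)
     ∨ (∃ i, M = embed (Zg 2) i)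
     ∨ (∃ i, M = embed (Zgd 2) i)
     ∨ (∃ i j, i ≠ j ∧ M = cnot i j)}

/-- The phase layer `D₁ ⊗ ⋯ ⊗ D_n` where `D_i = diag(1, e i)`. -/
def phaseLayer {n : ℕ} (e : Fin n → ℂ) : Matrix (Fin n → Bool) (Fin n → Bool) ℂ :=
  fun x y => if x = y then ∏ i, (if x i then e i else 1) else 0

/-- `z` is a valid phase-layer factor: `diag(1, z)` equals the identity, a `Z_{2^k}`
gate, or an adjoint thereof, i.e. `z = exp(iπ m / 2^k)` for some integers `m`, `k ≥ 0`. -/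
def validFactor (z : ℂ) : Prop :=
  ∃ (m : ℤ) (k : ℕ), z = Complex.exp (Real.pi * Complex.I * m / 2 ^ k)

/-- The permutation-like matrix `|y⟩ ↦ |f y⟩`. -/
def mapMat {n : ℕ} (f : (Fin n → Bool) → (Fin n → Bool)) :
    Matrix (Fin n → Bool) (Fin n → Bool) ℂ :=
  fun x y => if x = f y then 1 else 0

/-- The diagonal entry of `phaseLayer e` at the basis state `x`. -/
def layerPhase {n : ℕ} (e : Fin n → ℂ) (x : Fin n → Bool) : ℂ :=
  ∏ i, (if x i then e i else 1)

/-- The conjunction of the bits of index less than `t`. -/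
def allBelow {n : ℕ} (t : ℕ) (x : Fin n → Bool) : Bool :=
  decide (∀ j : Fin n, (j : ℕ) < t → x j = true)

/-- Increment modulo `2 ^ t` of the integer stored, least significant bit first, in the
bits of index less than `t`. -/
def incFun {n : ℕ} (t : ℕ) (x : Fin n → Bool) : Fin n → Bool :=
  fun k => if (k : ℕ) < t then xor (x k) (allBelow k x) else x k

/-- Flips bit `t` when all the bits below it are set. -/
def flipFun {n : ℕ} (t : Fin n) (x : Fin n → Bool) : Fin n → Bool :=
  Function.update x t (xor (x t) (allBelow t x))

/-- XORs bit `t` into the bits of index less than `s`. -/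
def fanFun {n : ℕ} (t : Fin n) (s : ℕ) (x : Fin n → Bool) : Fin n → Bool :=
  fun k => if (k : ℕ) < s then xor (x k) (x t) else x k

/-- The integer stored in the bits of index less than `t`. -/
def lowVal {n : ℕ} (t : ℕ) (x : Fin n → Bool) : ℕ :=
  ∑ k : Fin n, if (k : ℕ) < t ∧ x k = true then 2 ^ (k : ℕ) else 0

/-- The sign of the multiply-controlled `Z` gate on the bits of index at most `t`. -/
def ctrlSign {n : ℕ} (t : Fin n) (x : Fin n → Bool) : ℂ :=
  if x t && allBelow t x then -1 else 1

/-- `g` depends only on the bits of index less than `t`. -/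
def DependsBelow {n : ℕ} {α : Type*} (t : ℕ) (g : (Fin n → Bool) → α) : Prop :=
  ∀ x y : Fin n → Bool, (∀ k : Fin n, (k : ℕ) < t → x k = y k) → g x = g y

/-- `M` is a layered circuit of phase depth `d` and phase count at most `c`. -/
inductive Layered (n : ℕ) : ℕ → ℕ → Matrix (Fin n → Bool) (Fin n → Bool) ℂ → Prop
  | clifford {C : Matrix (Fin n → Bool) (Fin n → Bool) ℂ}
      (hC : C ∈ Submonoid.closure (cliffordGens n)) : Layered n 0 0 C
  | layer {d c k : ℕ} {C M : Matrix (Fin n → Bool) (Fin n → Bool) ℂ} {e : Fin n → ℂ}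
      (hC : C ∈ Submonoid.closure (cliffordGens n)) (he : ∀ i, validFactor (e i))
      (hk : Nat.card {i : Fin n // e i ≠ 1} ≤ k) (hM : Layered n d c M) :
      Layered n (d + 1) (k + c) (C * (phaseLayer e * M))

/-! ### Layered circuits -/

theorem Layered.clifford_mul {n d c : ℕ} {C M : Matrix (Fin n → Bool) (Fin n → Bool) ℂ}
    (hC : C ∈ Submonoid.closure (cliffordGens n)) (hM : Layered n d c M) :
    Layered n d c (C * M) := by
  cases hM with
  | clifford h => exact .clifford (mul_mem hC h)
  | layer h he hk hM =>
    rw [← mul_assoc]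
    exact .layer (mul_mem hC h) he hk hM

theorem Layered.mul {n d c d' c' : ℕ} {M M' : Matrix (Fin n → Bool) (Fin n → Bool) ℂ}
    (hM : Layered n d c M) (hM' : Layered n d' c' M') :
    Layered n (d + d') (c + c') (M * M') := by
  induction hM with
  | clifford h => simpa using hM'.clifford_mul h
  | @layer d c k C M e h he hk _ ih =>
    have := Layered.layer h he hk ih
    rw [show d + 1 + d' = d + d' + 1 by ring, add_assoc k, mul_assoc, mul_assoc]
    exact this

theorem Layered.phaseLayer {n k : ℕ} {e : Fin n → ℂ} (he : ∀ i, validFactor (e i))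
    (hk : Nat.card {i : Fin n // e i ≠ 1} ≤ k) : Layered n 1 k (phaseLayer e) := by
  simpa using Layered.layer (one_mem _) he hk (.clifford (one_mem _))

theorem Layered.exists_realization {n d c : ℕ} {M : Matrix (Fin n → Bool) (Fin n → Bool) ℂ}
    (hM : Layered n d c M) :
    ∃ (C : Fin (d + 1) → Matrix (Fin n → Bool) (Fin n → Bool) ℂ) (e : Fin d → Fin n → ℂ),
      (∀ i, C i ∈ Submonoid.closure (cliffordGens n)) ∧
      (∀ j i, validFactor (e j i)) ∧
      (∑ j : Fin d, Nat.card {i : Fin n // e j i ≠ 1}) ≤ c ∧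
      M = C 0 * (List.ofFn (fun j : Fin d => MCT.phaseLayer (e j) * C j.succ)).prod := by
  induction hM with
  | @clifford C h =>
    exact ⟨fun _ => C, fun j => j.elim0, fun _ => h, fun j => j.elim0, by simp, by simp⟩
  | @layer d c k C₀ M e₀ h he hk _ ih =>
    obtain ⟨C, e, hC, hv, hc, rfl⟩ := ih
    refine ⟨Fin.cons C₀ C, Fin.cons e₀ e, ?_, ?_, ?_, ?_⟩
    · intro i
      refine Fin.cases ?_ (fun i => ?_) i
      · simpa using h
      · simpa using hC i
    · intro j
      refine Fin.cases ?_ (fun j => ?_) j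
      · simpa using he
      · simpa using hv j
    · rw [Fin.sum_univ_succ]
      simpa using add_le_add hk hc
    · simp [List.ofFn_succ, mul_assoc]

/-! ### Matrix identities -/

theorem phaseLayer_eq_diagonal {n : ℕ} (e : Fin n → ℂ) :
    phaseLayer e = Matrix.diagonal (layerPhase e) := by
  ext x y
  by_cases h : x = y <;> simp [phaseLayer, layerPhase, h]

theorem mapMat_mul_mapMat {n : ℕ} (f g : (Fin n → Bool) → (Fin n → Bool)) :
    mapMat f * mapMat g = mapMat (f ∘ g) := by
  ext x y
  simp [Matrix.mul_apply, mapMat]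

theorem mapMat_id {n : ℕ} : mapMat (id : (Fin n → Bool) → (Fin n → Bool)) = 1 := by
  ext x y
  simp [mapMat, Matrix.one_apply]

theorem diagonal_mul_mapMat {n : ℕ} (g : (Fin n → Bool) → ℂ)
    (f : (Fin n → Bool) → (Fin n → Bool)) :
    Matrix.diagonal g * mapMat f = mapMat f * Matrix.diagonal (g ∘ f) := by
  ext x y
  by_cases h : x = f y <;> simp [mapMat, h]

theorem eq_update_of_eq_off {n : ℕ} {t : Fin n} {x y : Fin n → Bool}
    (h : ∀ j, j ≠ t → x j = y j) : y = Function.update x t (y t) := by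
  ext j
  by_cases hj : j = t
  · subst hj; simp
  · simp [hj, h j hj]

theorem embed_mul_apply {n : ℕ} (G : Matrix Bool Bool ℂ) (t : Fin n)
    (M : Matrix (Fin n → Bool) (Fin n → Bool) ℂ) (x y : Fin n → Bool) :
    (embed G t * M) x y = ∑ b : Bool, G (x t) b * M (Function.update x t b) y := by
  rw [Matrix.mul_apply]
  symm
  refine Finset.sum_of_injOn (fun b => Function.update x t b) ?_ ?_ ?_ ?_
  · intro a _ b _ h
    simpa using congrFun h t
  · intro b _; simp
  · intro z _ hz
    have : ¬ ∀ j, j ≠ t → x j = z j := fun h =>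
      hz ⟨z t, by simp, (eq_update_of_eq_off h).symm⟩
    simp [embed, this]
  · intro b _
    have : ∀ j, j ≠ t → x j = Function.update x t b j := fun j hj => by simp [hj]
    simp only [embed, if_pos this, one_mul, Function.update_self]

theorem mul_embed_apply {n : ℕ} (G : Matrix Bool Bool ℂ) (t : Fin n)
    (M : Matrix (Fin n → Bool) (Fin n → Bool) ℂ) (x y : Fin n → Bool) :
    (M * embed G t) x y = ∑ b : Bool, M x (Function.update y t b) * G b (y t) := by
  rw [Matrix.mul_apply]
  symm
  refine Finset.sum_of_injOn (fun b => Function.update y t b) ?_ ?_ ?_ ?_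
  · intro a _ b _ h
    simpa using congrFun h t
  · intro b _; simp
  · intro z _ hz
    have : ¬ ∀ j, j ≠ t → z j = y j := fun h =>
      hz ⟨z t, by simp, (eq_update_of_eq_off fun j hj => (h j hj).symm).symm⟩
    simp [embed, this]
  · intro b _
    have : ∀ j, j ≠ t → Function.update y t b j = y j := fun j hj => by simp [hj]
    simp only [embed, if_pos this, one_mul, Function.update_self]

theorem embed_mul_mapMat {n : ℕ} (G : Matrix Bool Bool ℂ) (t : Fin n)
    {f : (Fin n → Bool) → (Fin n → Bool)}
    (hf : ∀ y b, f (Function.update y t b) = Function.update (f y) t b) :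
    embed G t * mapMat f = mapMat f * embed G t := by
  have ht : ∀ y, f y t = y t := fun y => by
    have := congrFun (hf y (y t)) t
    simpa using this
  ext x y
  rw [mul_embed_apply, Matrix.mul_apply]
  simp only [mapMat, mul_ite, mul_one, mul_zero, Finset.sum_ite_eq', Finset.mem_univ, if_true, hf]
  by_cases h : ∀ j, j ≠ t → x j = f y j
  · have hx := eq_update_of_eq_off (fun j hj => (h j hj).symm)
    have : ∀ b, (x = Function.update (f y) t b) ↔ b = x t := by
      intro b
      constructor
      · intro e; rw [e]; simp
      · rintro rfl; exact hx
    simp only [embed, if_pos h, this, one_mul, ht]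
    simp
  · have : ∀ b, ¬ x = Function.update (f y) t b := by
      intro b e
      apply h
      intro j hj
      rw [e]; simp [hj]
    simp [embed, h, this]

theorem embed_mul_diagonal {n : ℕ} (G : Matrix Bool Bool ℂ) (t : Fin n)
    {g : (Fin n → Bool) → ℂ} (hg : DependsBelow t g) :
    embed G t * Matrix.diagonal g = Matrix.diagonal g * embed G t := by
  ext x y
  rw [Matrix.mul_diagonal, Matrix.diagonal_mul, mul_comm]
  by_cases h : ∀ j, j ≠ t → x j = y j
  · rw [hg x y fun k hk => h k (by rintro rfl; exact lt_irrefl _ hk)]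
  · simp [embed, h]

theorem allBelow_dependsBelow {n : ℕ} (t : ℕ) :
    DependsBelow t (allBelow t : (Fin n → Bool) → Bool) := by
  intro x y h
  unfold allBelow
  congr 1
  exact propext (forall_congr' fun j =>
    ⟨fun H hj => h j hj ▸ H hj, fun H hj => (h j hj).symm ▸ H hj⟩)

theorem allBelow_update {n : ℕ} (t : Fin n) (x : Fin n → Bool) (b : Bool) :
    allBelow t (Function.update x t b) = allBelow t x :=
  allBelow_dependsBelow _ _ _ fun k hk => by
    rw [Function.update_of_ne]; rintro rfl; exact lt_irrefl _ hk

theorem Hg_conj (a b c : Bool) :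
    ∑ s : Bool, Hg a s * ((if s && c then -1 else 1) * Hg s b) =
      if a = xor b c then 1 else 0 := by
  have h2 : ((Real.sqrt 2 : ℝ) : ℂ) ^ 2 = 2 := by
    rw [← Complex.ofReal_pow, Real.sq_sqrt (by norm_num)]; norm_num
  have h0 : ((Real.sqrt 2 : ℝ) : ℂ) ≠ 0 := by
    intro h; rw [h] at h2; norm_num at h2
  cases a <;> cases b <;> cases c <;> simp [Hg] <;> field_simp <;> rw [h2] <;> norm_num

theorem hadamard_conj_ctrlSign {n : ℕ} (t : Fin n) :
    embed Hg t * (Matrix.diagonal (ctrlSign t) * embed Hg t) = mapMat (flipFun t) := by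
  ext x y
  rw [embed_mul_apply]
  simp only [Matrix.diagonal_mul]
  have e1 : ∀ s : Bool, ctrlSign t (Function.update x t s) =
      if s && allBelow t x then -1 else 1 := by
    intro s; simp [ctrlSign, allBelow_update]
  simp only [e1]
  by_cases h : ∀ j, j ≠ t → x j = y j
  · have e2 : ∀ s : Bool, embed Hg t (Function.update x t s) y = Hg s (y t) := by
      intro s
      have : ∀ j, j ≠ t → Function.update x t s j = y j := fun j hj => by simp [hj, h j hj]
      simp only [embed, if_pos this, one_mul, Function.update_self]
    simp only [e2]
    rw [Hg_conj]
    have hb : allBelow t x = allBelow t y :=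
      allBelow_dependsBelow _ _ _ fun k hk => h k (by rintro rfl; exact lt_irrefl _ hk)
    have : (x = flipFun t y) ↔ x t = xor (y t) (allBelow t y) := by
      constructor
      · intro e; rw [e]; simp [flipFun]
      · intro e
        rw [flipFun, ← e]
        exact eq_update_of_eq_off fun j hj => (h j hj).symm
    simp only [mapMat, this, hb]
  · have e2 : ∀ s : Bool, embed Hg t (Function.update x t s) y = 0 := by
      intro s
      have : ¬ ∀ j, j ≠ t → Function.update x t s j = y j := fun H => h fun j hj => by
        simpa [hj] using H j hj
      simp only [embed, if_neg this, zero_mul]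
    have : ¬ x = flipFun t y := by
      rintro rfl
      exact h fun j hj => by simp [flipFun, hj]
    simp [e2, mapMat, this]

theorem hadamard_mul_self {n : ℕ} (t : Fin n) : embed Hg t * embed Hg t = 1 := by
  ext x y
  rw [embed_mul_apply]
  by_cases h : ∀ j, j ≠ t → x j = y j
  · have e2 : ∀ s : Bool, embed Hg t (Function.update x t s) y = Hg s (y t) := by
      intro s
      have : ∀ j, j ≠ t → Function.update x t s j = y j := fun j hj => by simp [hj, h j hj]
      simp only [embed, if_pos this, one_mul, Function.update_self]
    have := Hg_conj (x t) (y t) false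
    simp only [Bool.and_false, Bool.false_eq_true, if_false, one_mul, Bool.xor_false] at this
    simp only [e2, this, Matrix.one_apply]
    have hxy : x = y ↔ x t = y t := ⟨fun e => e ▸ rfl, fun e => by
      rw [eq_update_of_eq_off h, ← e, Function.update_eq_self]⟩
    simp only [hxy]
  · have e2 : ∀ s : Bool, embed Hg t (Function.update x t s) y = 0 := by
      intro s
      have : ¬ ∀ j, j ≠ t → Function.update x t s j = y j := fun H => h fun j hj => by
        simpa [hj] using H j hj
      simp only [embed, if_neg this, zero_mul]
    have : x ≠ y := fun e => h fun j _ => by rw [e]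
    simp [e2, this]

/-! ### Bit functions -/

theorem allBelow_zero {n : ℕ} (x : Fin n → Bool) : allBelow 0 x = true := by
  simp [allBelow]

theorem allBelow_succ {n : ℕ} (t : Fin n) (x : Fin n → Bool) :
    allBelow (t + 1) x = (x t && allBelow t x) := by
  rw [Bool.eq_iff_iff]
  simp only [allBelow, decide_eq_true_eq, Bool.and_eq_true]
  constructor
  · exact fun h => ⟨h t (Nat.lt_succ_self _), fun j hj => h j (Nat.lt_succ_of_lt hj)⟩
  · rintro ⟨h1, h2⟩ j hj
    rcases Nat.lt_succ_iff_lt_or_eq.mp hj with h | h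
    · exact h2 j h
    · rwa [Fin.ext h]

theorem incFun_of_lt {n : ℕ} {t : ℕ} {k : Fin n} (h : (k : ℕ) < t) (x : Fin n → Bool) :
    incFun t x k = xor (x k) (allBelow k x) := by
  simp [incFun, h]

theorem incFun_of_le {n : ℕ} {t : ℕ} {k : Fin n} (h : t ≤ (k : ℕ)) (x : Fin n → Bool) :
    incFun t x k = x k := by
  simp [incFun, h.not_gt]

theorem incFun_zero {n : ℕ} : (incFun 0 : (Fin n → Bool) → (Fin n → Bool)) = id := by
  ext x k; simp [incFun]

theorem flipFun_of_ne {n : ℕ} {t k : Fin n} (h : k ≠ t) (x : Fin n → Bool) :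
    flipFun t x k = x k := by
  simp [flipFun, h]

theorem flipFun_self {n : ℕ} (t : Fin n) (x : Fin n → Bool) :
    flipFun t x t = xor (x t) (allBelow t x) := by
  simp [flipFun]

theorem flipFun_comp_self {n : ℕ} (t : Fin n) :
    (flipFun t ∘ flipFun t : (Fin n → Bool) → (Fin n → Bool)) = id := by
  funext x
  simp [flipFun, allBelow_update]

theorem incFun_succ {n : ℕ} (t : Fin n) :
    (incFun (t + 1) : (Fin n → Bool) → (Fin n → Bool)) = incFun t ∘ flipFun t := by
  funext x k
  rw [Function.comp_apply]
  rcases lt_trichotomy (k : ℕ) t with h | h | h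
  · have hk : k ≠ t := by rintro rfl; exact lt_irrefl _ h
    rw [incFun_of_lt (Nat.lt_succ_of_lt h), incFun_of_lt h, flipFun_of_ne hk]
    congr 1
    refine allBelow_dependsBelow _ _ _ fun j hj => (flipFun_of_ne ?_ x).symm
    rintro rfl; omega
  · obtain rfl := Fin.ext h
    rw [incFun_of_lt (Nat.lt_succ_self _), incFun_of_le le_rfl, flipFun_self]
  · have hk : k ≠ t := by rintro rfl; exact lt_irrefl _ h
    rw [incFun_of_le h, incFun_of_le h.le, flipFun_of_ne hk]

theorem incFun_update {n : ℕ} (t : Fin n) (x : Fin n → Bool) (b : Bool) :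
    incFun t (Function.update x t b) = Function.update (incFun t x) t b := by
  funext k
  by_cases hk : k = t
  · subst hk; simp [incFun_of_le]
  · rw [Function.update_of_ne hk]
    unfold incFun
    split_ifs with h
    · rw [Function.update_of_ne hk]
      congr 1
      refine allBelow_dependsBelow _ _ _ fun j hj => Function.update_of_ne ?_ _ _
      rintro rfl; omega
    · rw [Function.update_of_ne hk]

theorem incFun_congr {n t : ℕ} {x y : Fin n → Bool}
    (h : ∀ k : Fin n, (k : ℕ) < t → x k = y k) (k : Fin n) (hk : (k : ℕ) < t) :
    incFun t x k = incFun t y k := by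
  rw [incFun_of_lt hk, incFun_of_lt hk, h k hk,
    allBelow_dependsBelow _ x y fun j hj => h j (hj.trans hk)]

theorem fanFun_fanFun {n : ℕ} (t : Fin n) (x : Fin n → Bool) :
    fanFun t t (fanFun t t x) = x := by
  funext k
  simp only [fanFun, lt_irrefl, if_false]
  split_ifs <;> simp

theorem fanFun_apply_self {n : ℕ} (t : Fin n) (x : Fin n → Bool) : fanFun t t x t = x t := by
  simp [fanFun]

theorem lowVal_dependsBelow {n : ℕ} (t : ℕ) :
    DependsBelow t (lowVal t : (Fin n → Bool) → ℕ) := by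
  intro x y h
  refine Finset.sum_congr rfl fun k _ => ?_
  by_cases hk : (k : ℕ) < t
  · rw [h k hk]
  · simp [hk]

theorem lowVal_succ {n : ℕ} (t : Fin n) (x : Fin n → Bool) :
    lowVal (t + 1) x = lowVal t x + if x t = true then 2 ^ (t : ℕ) else 0 := by
  have : (if x t = true then 2 ^ (t : ℕ) else 0) =
      ∑ k : Fin n, if k = t then (if x k = true then 2 ^ (k : ℕ) else 0) else 0 := by simp
  rw [this, lowVal, lowVal, ← Finset.sum_add_distrib]
  refine Finset.sum_congr rfl fun k _ => ?_
  rcases lt_trichotomy (k : ℕ) t with h | h | h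
  · have hk : k ≠ t := by rintro rfl; exact lt_irrefl _ h
    simp [h, hk, Nat.lt_succ_of_lt h]
  · obtain rfl := Fin.ext h
    simp
  · have hk : k ≠ t := by rintro rfl; exact lt_irrefl _ h
    simp [hk, h.not_gt, not_lt.mpr (Nat.succ_le_of_lt h)]

theorem lowVal_incFun {n : ℕ} (x : Fin n → Bool) (t : ℕ) (ht : t ≤ n) :
    lowVal t (incFun t x) + (if allBelow t x = true then 2 ^ t else 0) = lowVal t x + 1 := by
  induction t with
  | zero => simp [allBelow_zero, lowVal]
  | succ t ih =>
    have ih := ih (by omega)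
    have hs := lowVal_succ (⟨t, ht⟩ : Fin n)
    have ha := allBelow_succ (⟨t, ht⟩ : Fin n) x
    simp only at hs ha
    have hd : lowVal t (incFun (t + 1) x) = lowVal t (incFun t x) :=
      lowVal_dependsBelow t _ _ fun k hk => by
        rw [incFun_of_lt hk, incFun_of_lt (Nat.lt_succ_of_lt hk)]
    rw [hs, hs, ha, hd,
      incFun_of_lt (show ((⟨t, ht⟩ : Fin n) : ℕ) < t + 1 from Nat.lt_succ_self t), pow_succ]
    simp only
    cases x ⟨t, ht⟩ <;> cases hb : allBelow t x <;> simp [hb] at ih ⊢ <;> omega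

theorem lowVal_fanFun_of_true {n : ℕ} (t : Fin n) (x : Fin n → Bool) (hx : x t = true)
    (s : ℕ) (hs : s ≤ t) : lowVal s (fanFun t t x) + lowVal s x + 1 = 2 ^ s := by
  induction s with
  | zero => simp [lowVal]
  | succ s ih =>
    have ih := ih (by omega)
    have hs' := lowVal_succ (⟨s, by omega⟩ : Fin n)
    have hb : fanFun t t x ⟨s, by omega⟩ = !x ⟨s, by omega⟩ := by
      simp [fanFun, Nat.lt_of_succ_le hs, hx]
    simp only at hs'
    rw [hs', hs', hb, pow_succ]
    cases x ⟨s, by omega⟩ <;> simp <;> omega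

theorem fanFun_of_false {n : ℕ} (t : Fin n) (x : Fin n → Bool) (hx : x t = false) :
    fanFun t t x = x := by
  funext k; simp [fanFun, hx]

/-! ### Clifford elements -/

theorem hadamard_mem {n : ℕ} (t : Fin n) :
    embed Hg t ∈ Submonoid.closure (cliffordGens n) :=
  Submonoid.subset_closure (Or.inl ⟨t, rfl⟩)

theorem cnot_eq_mapMat {n : ℕ} (i j : Fin n) :
    cnot i j = mapMat fun y => Function.update y j (xor (y j) (y i)) := by
  ext x y
  simp only [cnot, mapMat]
  congr 1
  rw [Function.eq_update_iff, and_comm]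

theorem mapMat_fanFun_mem {n : ℕ} (t : Fin n) (s : ℕ) (hs : s ≤ t) :
    mapMat (fanFun t s) ∈ Submonoid.closure (cliffordGens n) := by
  induction s with
  | zero =>
    have : (fanFun t 0 : (Fin n → Bool) → (Fin n → Bool)) = id := by funext x k; simp [fanFun]
    rw [this, mapMat_id]
    exact one_mem _
  | succ s ih =>
    have hne : t ≠ ⟨s, by omega⟩ := by
      intro h; have := congrArg Fin.val h; simp only at this; omega
    have : mapMat (fanFun t (s + 1)) = cnot t ⟨s, by omega⟩ * mapMat (fanFun t s) := by
      rw [cnot_eq_mapMat, mapMat_mul_mapMat]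
      congr 1
      funext x k
      have ht : fanFun t s x t = x t := by simp [fanFun]; omega
      rw [Function.comp_apply, ht]
      by_cases hk : k = ⟨s, by omega⟩
      · subst hk; simp [fanFun]
      · have hk' : (k : ℕ) ≠ s := fun h => hk (Fin.ext h)
        have : (k : ℕ) < s + 1 ↔ (k : ℕ) < s := by omega
        simp [fanFun, hk, this]
    rw [this]
    exact mul_mem (Submonoid.subset_closure (Or.inr (Or.inr (Or.inr ⟨_, _, hne, rfl⟩))))
      (ih (by omega))

theorem phaseGate_sq {n : ℕ} {t : Fin n} (ht : (t : ℕ) = 0) :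
    embed (Zg 2) t * embed (Zg 2) t = Matrix.diagonal (ctrlSign t) := by
  have hS : embed (Zg 2) t = Matrix.diagonal fun x => if x t then Complex.I else 1 := by
    ext x y
    have hexp : Complex.exp (Real.pi * Complex.I / (2 : ℕ)) = Complex.I := by
      rw [show (Real.pi * Complex.I / (2 : ℕ) : ℂ) = Real.pi / 2 * Complex.I by push_cast; ring,
        Complex.exp_pi_div_two_mul_I]
    by_cases h : x = y
    · subst h; simp only [embed, Zg, hexp]; simp
    · have : ¬ ((∀ j, j ≠ t → x j = y j) ∧ x t = y t) := fun H => h <| by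
        rw [eq_update_of_eq_off H.1, ← H.2, Function.update_eq_self]
      rw [Matrix.diagonal_apply_ne _ h]
      by_cases h1 : ∀ j, j ≠ t → x j = y j
      · have : x t ≠ y t := fun H => this ⟨h1, H⟩
        simp [embed, Zg, this]
      · simp [embed, h1]
  rw [hS, Matrix.diagonal_mul_diagonal]
  congr 1
  funext x
  simp only [ctrlSign, ht, allBelow_zero]
  cases x t <;> simp

theorem mapMat_flipFun_zero_mem {n : ℕ} {t : Fin n} (ht : (t : ℕ) = 0) :
    mapMat (flipFun t) ∈ Submonoid.closure (cliffordGens n) := by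
  have hS : embed (Zg 2) t ∈ Submonoid.closure (cliffordGens n) :=
    Submonoid.subset_closure (Or.inr (Or.inl ⟨t, rfl⟩))
  rw [← hadamard_conj_ctrlSign, ← phaseGate_sq ht]
  exact mul_mem (hadamard_mem t) (mul_mem (mul_mem hS hS) (hadamard_mem t))

theorem mapMat_flipFun_one_mem {n : ℕ} {s t : Fin n} (hs : (s : ℕ) = 0) (ht : (t : ℕ) = 1) :
    mapMat (flipFun t) ∈ Submonoid.closure (cliffordGens n) := by
  have : mapMat (flipFun t) = cnot s t := by
    rw [cnot_eq_mapMat]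
    congr 1
    funext x
    have := allBelow_succ s x
    rw [hs, allBelow_zero, Bool.and_true] at this
    rw [flipFun, ht, ← this]
  rw [this]
  refine Submonoid.subset_closure (Or.inr (Or.inr (Or.inr ⟨s, t, ?_, rfl⟩)))
  rintro rfl; omega

/-! ### Phase factors -/

theorem validFactor_one : validFactor 1 := ⟨0, 0, by simp⟩

theorem validFactor.inv {z : ℂ} (hz : validFactor z) : validFactor z⁻¹ := by
  obtain ⟨m, k, rfl⟩ := hz
  refine ⟨-m, k, ?_⟩
  rw [← Complex.exp_neg]
  congr 1; push_cast; ring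

theorem validFactor.mul {z w : ℂ} (hz : validFactor z) (hw : validFactor w) :
    validFactor (z * w) := by
  obtain ⟨m, k, rfl⟩ := hz
  obtain ⟨m', k', rfl⟩ := hw
  refine ⟨m * 2 ^ k' + m' * 2 ^ k, k + k', ?_⟩
  rw [← Complex.exp_add, pow_add]
  congr 1; push_cast; field_simp

theorem validFactor.pow {z : ℂ} (hz : validFactor z) (j : ℕ) : validFactor (z ^ j) := by
  induction j with
  | zero => simpa using validFactor_one
  | succ j ih => rw [pow_succ]; exact ih.mul hz

theorem validFactor.ne_zero {z : ℂ} (hz : validFactor z) : z ≠ 0 := by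
  obtain ⟨m, k, rfl⟩ := hz
  exact Complex.exp_ne_zero _

theorem exists_validFactor_pow_eq_neg_one (k : ℕ) :
    ∃ z : ℂ, validFactor z ∧ z ^ 2 ^ k = -1 := by
  refine ⟨_, ⟨1, k, rfl⟩, ?_⟩
  rw [← Complex.exp_nat_mul, ← Complex.exp_pi_mul_I]
  congr 1; push_cast; field_simp

theorem validFactor_mulSingle {n : ℕ} (t : Fin n) {z : ℂ} (hz : validFactor z) (i : Fin n) :
    validFactor ((Pi.mulSingle t z : Fin n → ℂ) i) := by
  rw [Pi.mulSingle_apply]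
  split_ifs
  exacts [hz, validFactor_one]

/-- The phase factors `ω ^ 2 ^ k` on the qubits `k < t`. -/
def lowWeights {n : ℕ} (t : ℕ) (ω : ℂ) : Fin n → ℂ :=
  fun k => if (k : ℕ) < t then ω ^ 2 ^ (k : ℕ) else 1

theorem validFactor_lowWeights {n : ℕ} (t : ℕ) {ω : ℂ} (hω : validFactor ω) (i : Fin n) :
    validFactor (lowWeights t ω i) := by
  unfold lowWeights
  split_ifs
  exacts [hω.pow _, validFactor_one]

theorem layerPhase_mul {n : ℕ} (e e' : Fin n → ℂ) (x : Fin n → Bool) :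
    layerPhase (e * e') x = layerPhase e x * layerPhase e' x := by
  rw [layerPhase, layerPhase, layerPhase, ← Finset.prod_mul_distrib]
  refine Finset.prod_congr rfl fun i _ => ?_
  split_ifs <;> simp

theorem layerPhase_inv {n : ℕ} (e : Fin n → ℂ) (x : Fin n → Bool) :
    layerPhase e⁻¹ x = (layerPhase e x)⁻¹ := by
  rw [layerPhase, layerPhase, ← Finset.prod_inv_distrib]
  refine Finset.prod_congr rfl fun i _ => ?_
  split_ifs <;> simp

theorem layerPhase_mulSingle {n : ℕ} (t : Fin n) (z : ℂ) (x : Fin n → Bool) :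
    layerPhase (Pi.mulSingle t z) x = if x t then z else 1 := by
  rw [layerPhase, Finset.prod_eq_single t]
  · simp
  · intro i _ hi; simp [hi]
  · simp

theorem layerPhase_lowWeights {n : ℕ} (t : ℕ) (ω : ℂ) (x : Fin n → Bool) :
    layerPhase (lowWeights t ω) x = ω ^ lowVal t x := by
  rw [lowVal, ← Finset.prod_pow_eq_pow_sum]
  refine Finset.prod_congr rfl fun i _ => ?_
  cases h : x i <;> simp [lowWeights]

theorem layerPhase_ne_zero {n : ℕ} {e : Fin n → ℂ} (he : ∀ i, validFactor (e i))
    (x : Fin n → Bool) : layerPhase e x ≠ 0 :=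
  Finset.prod_ne_zero_iff.mpr fun i _ => by
    split_ifs
    exacts [(he i).ne_zero, one_ne_zero]

theorem card_ne_one_le {n : ℕ} {e : Fin n → ℂ} (F : Finset (Fin n)) (h : ∀ i, i ∉ F → e i = 1) :
    Nat.card {i : Fin n // e i ≠ 1} ≤ F.card := by
  classical
  rw [Nat.card_eq_fintype_card, Fintype.card_subtype]
  refine Finset.card_le_card fun i hi => ?_
  by_contra hF
  exact (Finset.mem_filter.mp hi).2 (h i hF)

theorem card_ne_one_le_of_le {n : ℕ} {e : Fin n → ℂ} (s : ℕ)
    (h : ∀ i : Fin n, s ≤ (i : ℕ) → e i = 1) : Nat.card {i : Fin n // e i ≠ 1} ≤ s := by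
  have hs : ∀ i : {i : Fin n // e i ≠ 1}, (i.1 : ℕ) < s := fun i => by
    by_contra hi
    exact i.2 (h i.1 (not_lt.mp hi))
  have := Nat.card_le_card_of_injective
    (fun i : {i : Fin n // e i ≠ 1} => (⟨i.1, hs i⟩ : Fin s))
    (fun a b hab => Subtype.ext (Fin.ext (by simpa using hab)))
  simpa using this

/-- The phase picked up by a parity layer conjugating the `t`-bit increment. -/
theorem layerPhase_incFun {n : ℕ} (t : Fin n) {ω : ℂ} (hω : ω ^ 2 ^ ((t : ℕ) + 1) = -1)
    (x : Fin n → Bool) :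
    layerPhase (lowWeights t ω * Pi.mulSingle t (ω ^ 2)) (fanFun t t (incFun t x)) *
        layerPhase (lowWeights t ω)⁻¹ (fanFun t t x) * ω ^ lowVal t x =
      ctrlSign t x * ω ^ lowVal t (incFun t x) := by
  have h0 : ω ≠ 0 := by
    rintro rfl
    simp at hω
  simp only [layerPhase_mul, layerPhase_inv, layerPhase_lowWeights, layerPhase_mulSingle,
    fanFun_apply_self, incFun_of_le le_rfl]
  have hinc := lowVal_incFun x t t.2.le
  cases hx : x t with
  | false =>
    have hx' : incFun t x t = false := by rw [incFun_of_le le_rfl, hx]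
    rw [fanFun_of_false t x hx, fanFun_of_false t _ hx']
    simp [ctrlSign, hx, h0]
  | true =>
    have hx' : incFun t x t = true := by rw [incFun_of_le le_rfl, hx]
    have h1 := lowVal_fanFun_of_true t x hx t le_rfl
    have h2 := lowVal_fanFun_of_true t _ hx' t le_rfl
    generalize lowVal t (fanFun t t x) = B at *
    generalize lowVal t (fanFun t t (incFun t x)) = A at *
    generalize lowVal t (incFun t x) = N' at *
    generalize lowVal t x = N at *
    simp only [if_true]
    suffices ω ^ (A + 2 + N) = ctrlSign t x * ω ^ (N' + B) by
      rw [pow_add, pow_add, pow_add] at this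
      field_simp
      linear_combination this
    cases hb : allBelow t x with
    | false =>
      simp only [hb, Bool.false_eq_true, if_false] at hinc
      rw [show A + 2 + N = N' + B by omega]
      simp [ctrlSign, hb]
    | true =>
      simp only [hb, if_true] at hinc
      rw [show A + 2 + N = 2 ^ ((t : ℕ) + 1) by rw [pow_succ]; omega,
        show N' + B = 0 by omega, hω]
      simp [ctrlSign, hb, hx]

/-! ### Growing the increment one bit at a time -/

/-- The parity layer applying the phases `e` to the bits `x_k ⊕ x_t` (`k < t`) and `x_k`
(`t ≤ k`). -/
def parityLayer {n : ℕ} (t : Fin n) (e : Fin n → ℂ) :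
    Matrix (Fin n → Bool) (Fin n → Bool) ℂ :=
  mapMat (fanFun t t) * (phaseLayer e * mapMat (fanFun t t))

theorem parityLayer_eq_diagonal {n : ℕ} (t : Fin n) (e : Fin n → ℂ) :
    parityLayer t e = Matrix.diagonal (layerPhase e ∘ fanFun t t) := by
  have : (fanFun t t ∘ fanFun t t : (Fin n → Bool) → (Fin n → Bool)) = id :=
    funext (fanFun_fanFun t)
  rw [parityLayer, phaseLayer_eq_diagonal, diagonal_mul_mapMat, ← mul_assoc, mapMat_mul_mapMat,
    this, mapMat_id, one_mul]

theorem layered_parityLayer {n k : ℕ} (t : Fin n) {e : Fin n → ℂ} (he : ∀ i, validFactor (e i))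
    (hk : Nat.card {i : Fin n // e i ≠ 1} ≤ k) : Layered n 1 k (parityLayer t e) := by
  have h := mapMat_fanFun_mem t t le_rfl
  exact Layered.layer h he hk (.clifford h)

theorem parityLayer_inv_mul {n : ℕ} (t : Fin n) {e : Fin n → ℂ} (he : ∀ i, validFactor (e i)) :
    parityLayer t e⁻¹ * parityLayer t e = 1 := by
  rw [parityLayer_eq_diagonal, parityLayer_eq_diagonal, Matrix.diagonal_mul_diagonal,
    ← Matrix.diagonal_one]
  congr 1
  funext x
  simp [layerPhase_inv, layerPhase_ne_zero he]

/-- The increment modulo `2 ^ m`, up to a diagonal matrix acting on the same `m` bits, and its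
inverse both admit layered circuits of depth `d` and count at most `c`. -/
def HasIncrement (n m d c : ℕ) : Prop :=
  ∃ (g : (Fin n → Bool) → ℂ) (K' : Matrix (Fin n → Bool) (Fin n → Bool) ℂ),
    DependsBelow m g ∧ Layered n d c (mapMat (incFun m) * Matrix.diagonal g) ∧
    Layered n d c K' ∧ K' * (mapMat (incFun m) * Matrix.diagonal g) = 1

theorem diagonal_conj_increment {n m : ℕ} (a b g : (Fin n → Bool) → ℂ) :
    Matrix.diagonal b * (mapMat (incFun m) * Matrix.diagonal g) * Matrix.diagonal a =
      mapMat (incFun m) * Matrix.diagonal g * Matrix.diagonal fun x => b (incFun m x) * a x := by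
  rw [← mul_assoc, diagonal_mul_mapMat]
  simp only [mul_assoc, Matrix.diagonal_mul_diagonal]
  congr 2
  funext x
  simp only [Function.comp_apply]
  ring

theorem HasIncrement.succ {n d c k k' : ℕ} (t : Fin n) (hinc : HasIncrement n t d c)
    {e e' : Fin n → ℂ} (he : ∀ i, validFactor (e i)) (he' : ∀ i, validFactor (e' i))
    (hk : Nat.card {i : Fin n // e i ≠ 1} ≤ k) (hk' : Nat.card {i : Fin n // e' i ≠ 1} ≤ k')
    {h : (Fin n → Bool) → ℂ} (hh : DependsBelow t h)
    (hphase : ∀ x, layerPhase e' (fanFun t t (incFun t x)) * layerPhase e (fanFun t t x) =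
      ctrlSign t x * h x) :
    HasIncrement n (t + 1) (d + 2) (c + k + k') := by
  obtain ⟨g, K', hg, hK, hK', hinv⟩ := hinc
  have hcard : ∀ f : Fin n → ℂ, Nat.card {i : Fin n // f⁻¹ i ≠ 1} =
      Nat.card {i : Fin n // f i ≠ 1} := fun f => by simp
  have hgh : DependsBelow t fun x => g x * h x := fun x y H => by
    simp only [hg x y H, hh x y H]
  have key : mapMat (incFun (t + 1)) * Matrix.diagonal (fun x => g x * h x) =
      embed Hg t * (parityLayer t e' * (mapMat (incFun t) * Matrix.diagonal g) *
        parityLayer t e * embed Hg t) := by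
    rw [parityLayer_eq_diagonal, parityLayer_eq_diagonal, diagonal_conj_increment]
    simp only [Function.comp_apply, hphase]
    have : (Matrix.diagonal g * Matrix.diagonal fun x => ctrlSign t x * h x) =
        Matrix.diagonal (fun x => g x * h x) * Matrix.diagonal (ctrlSign t) := by
      simp only [Matrix.diagonal_mul_diagonal]
      congr 1
      funext x
      ring
    rw [mul_assoc (mapMat _), this, mul_assoc, ← mul_assoc (embed Hg t),
      embed_mul_mapMat _ _ (incFun_update t), mul_assoc, mul_assoc, ← mul_assoc (embed Hg t),
      embed_mul_diagonal _ _ hgh, mul_assoc, hadamard_conj_ctrlSign, diagonal_mul_mapMat,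
      ← mul_assoc, mapMat_mul_mapMat, ← incFun_succ]
    congr 2
    funext x
    refine hgh _ _ fun j hj => (flipFun_of_ne ?_ x).symm
    rintro rfl; exact lt_irrefl _ hj
  refine ⟨fun x => g x * h x,
    embed Hg t * (parityLayer t e⁻¹ * K' * parityLayer t e'⁻¹ * embed Hg t), ?_, ?_, ?_, ?_⟩
  · exact fun x y H => hgh x y fun j hj => H j (Nat.lt_succ_of_lt hj)
  · rw [key]
    have := (((layered_parityLayer t he' hk').mul hK).mul (layered_parityLayer t he hk)).mul
      (.clifford (hadamard_mem t))
    convert this.clifford_mul (hadamard_mem t) using 1 <;> ring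
  · have := (((layered_parityLayer t (e := e⁻¹)
      (fun i => (he i).inv) ((hcard e).trans_le hk)).mul hK').mul
      (layered_parityLayer t (e := e'⁻¹) (fun i => (he' i).inv) ((hcard e').trans_le hk'))).mul
      (.clifford (hadamard_mem t))
    convert this.clifford_mul (hadamard_mem t) using 1 <;> ring
  · rw [key]
    generalize mapMat (incFun t) * Matrix.diagonal g = K at *
    calc _ = embed Hg t * parityLayer t e⁻¹ * K' * parityLayer t e'⁻¹ *
          (embed Hg t * embed Hg t) * parityLayer t e' * K * parityLayer t e * embed Hg t := by
            simp only [mul_assoc]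
      _ = embed Hg t * parityLayer t e⁻¹ * K' * (parityLayer t e'⁻¹ * parityLayer t e') * K *
          parityLayer t e * embed Hg t := by rw [hadamard_mul_self, mul_one]; simp only [mul_assoc]
      _ = embed Hg t * parityLayer t e⁻¹ * (K' * K) * parityLayer t e * embed Hg t := by
            rw [parityLayer_inv_mul t he', mul_one]; simp only [mul_assoc]
      _ = embed Hg t * (parityLayer t e⁻¹ * parityLayer t e) * embed Hg t := by
            rw [hinv, mul_one]; simp only [mul_assoc]
      _ = 1 := by rw [parityLayer_inv_mul t he, mul_one, hadamard_mul_self]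

theorem hasIncrement_two {n : ℕ} (hn : 2 ≤ n) : HasIncrement n 2 0 0 := by
  let s : Fin n := ⟨0, by omega⟩
  let t : Fin n := ⟨1, by omega⟩
  have hs := mapMat_flipFun_zero_mem (t := s) rfl
  have ht := mapMat_flipFun_one_mem (s := s) (t := t) rfl rfl
  have hinc : mapMat (incFun 2) = mapMat (flipFun s) * mapMat (flipFun t) := by
    have h1 := incFun_succ s
    have h2 := incFun_succ t
    simp only [s, t, zero_add, Nat.reduceAdd, incFun_zero, Function.id_comp] at h1 h2
    rw [mapMat_mul_mapMat, h2, h1]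
  have hone : mapMat (incFun 2) * Matrix.diagonal (fun _ : Fin n → Bool => (1 : ℂ)) =
      mapMat (flipFun s) * mapMat (flipFun t) := by
    rw [Matrix.diagonal_one, mul_one, hinc]
  refine ⟨fun _ => 1, mapMat (flipFun t) * mapMat (flipFun s), fun _ _ _ => rfl, ?_, ?_, ?_⟩
  · rw [hone]
    exact .clifford (mul_mem hs ht)
  · exact .clifford (mul_mem ht hs)
  · rw [hone, mul_assoc, ← mul_assoc (mapMat (flipFun s)), mapMat_mul_mapMat, flipFun_comp_self,
      mapMat_id, one_mul, mapMat_mul_mapMat, flipFun_comp_self, mapMat_id]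

theorem hasIncrement_three {n : ℕ} (hn : 3 ≤ n) : HasIncrement n 3 2 4 := by
  obtain ⟨z, hz, hz4⟩ := exists_validFactor_pow_eq_neg_one 2
  let i₀ : Fin n := ⟨0, by omega⟩
  let i₁ : Fin n := ⟨1, by omega⟩
  let t : Fin n := ⟨2, by omega⟩
  have hcard : ∀ (i j : Fin n) (z w : ℂ),
      Nat.card {l : Fin n // (Pi.mulSingle i z * Pi.mulSingle j w : Fin n → ℂ) l ≠ 1} ≤ 2 := by
    intro i j z w
    refine (card_ne_one_le {i, j} fun l hl => ?_).trans Finset.card_le_two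
    simp only [Finset.mem_insert, Finset.mem_singleton, not_or] at hl
    simp [hl.1, hl.2]
  refine HasIncrement.succ t (hasIncrement_two (by omega))
    (e := Pi.mulSingle t z * Pi.mulSingle i₁ z⁻¹) (e' := Pi.mulSingle i₀ z * Pi.mulSingle i₁ z)
    (fun i => (validFactor_mulSingle _ hz i).mul (validFactor_mulSingle _ hz.inv i))
    (fun i => (validFactor_mulSingle _ hz i).mul (validFactor_mulSingle _ hz i))
    (hcard _ _ _ _) (hcard _ _ _ _)
    (h := fun x => if x i₀ && x i₁ then z⁻¹ else z) ?_ ?_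
  · intro x y H
    simp only [H i₀ (show 0 < 2 by norm_num), H i₁ (show 1 < 2 by norm_num)]
  · intro x
    have h0 := hz.ne_zero
    have hz2 : z ^ 4 = -1 := by simpa using hz4
    have a1 := allBelow_succ i₀ x
    have a2 := allBelow_succ i₁ x
    simp only [i₀, i₁, zero_add, Nat.reduceAdd, allBelow_zero, Bool.and_true] at a1 a2
    rw [a1] at a2
    simp only [layerPhase_mul, layerPhase_mulSingle, ctrlSign, fanFun, incFun, i₀, i₁, t,
      allBelow_zero, a1, a2]
    simp only [Nat.lt_irrefl, Nat.one_lt_two, Nat.zero_lt_two, if_true, if_false]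
    generalize x ⟨0, _⟩ = a
    generalize x ⟨1, _⟩ = b
    generalize x ⟨2, _⟩ = y
    cases a <;> cases b <;> cases y <;>
      simp [h0] <;> (field_simp; linear_combination hz2)

theorem hasIncrement {n : ℕ} (m : ℕ) (hm : 3 ≤ m) (hn : m ≤ n) :
    HasIncrement n m (2 * (m - 2)) (m ^ 2 - 5) := by
  induction m, hm using Nat.le_induction with
  | base => exact hasIncrement_three hn
  | succ m hm ih =>
    let t : Fin n := ⟨m, hn⟩
    obtain ⟨ω, hω, hω'⟩ := exists_validFactor_pow_eq_neg_one (m + 1)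
    have h0 := hω.ne_zero
    have := HasIncrement.succ t (ih (by omega))
      (e := (lowWeights t ω)⁻¹) (e' := lowWeights t ω * Pi.mulSingle t (ω ^ 2))
      (k := m) (k' := m + 1)
      (fun i => (validFactor_lowWeights _ hω i).inv)
      (fun i => (validFactor_lowWeights _ hω i).mul (validFactor_mulSingle _ (hω.pow 2) i))
      (card_ne_one_le_of_le m fun i hi => by simp [lowWeights, t, hi.not_gt])
      (card_ne_one_le_of_le (m + 1) fun i hi => by
        have : i ≠ t := by rintro rfl; simp [t] at hi
        have hi' : ¬ (i : ℕ) < m := by omega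
        simp [lowWeights, this, t, hi'])
      (h := fun x => ω ^ lowVal m (incFun m x) * (ω ^ lowVal m x)⁻¹)
      (fun x y H => by
        simp only
        rw [lowVal_dependsBelow m x y H, lowVal_dependsBelow m _ _ (incFun_congr H)])
      (fun x => by
        have := layerPhase_incFun t hω' x
        rw [← mul_assoc, ← this, mul_assoc, mul_inv_cancel₀ (pow_ne_zero _ h0), mul_one])
    convert this using 1
    · omega
    · have : 9 ≤ m ^ 2 := by nlinarith
      have h2 : (m + 1) ^ 2 = m ^ 2 + 2 * m + 1 := by ring
      omega

theorem mct_eq_mapMat {n : ℕ} (t : Fin n) (ht : (t : ℕ) + 1 = n) : mct n = mapMat (flipFun t) := by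
  have : mctFun n = flipFun t := by
    funext y k
    by_cases hk : k = t
    · subst hk
      have : (k : ℕ) = n - 1 := by omega
      rw [flipFun_self]
      simp only [mctFun, allBelow, this, if_true]
    · have : ¬ (k : ℕ) = n - 1 := fun h => hk (Fin.ext (by omega))
      rw [flipFun_of_ne hk]
      simp only [mctFun, if_neg this]
  ext x y
  simp only [mct, mapMat, this]

theorem layered_mct {n d c : ℕ} (t : Fin n) (ht : (t : ℕ) + 1 = n)
    (hinc : HasIncrement n t d c) :
    Layered n (2 * d + 4) (2 * c + 4 * t + 1) (mct n) := by
  obtain ⟨g, K', hg, hK, hK', hinv⟩ := hinc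
  obtain ⟨ω, hω, hω'⟩ := exists_validFactor_pow_eq_neg_one ((t : ℕ) + 1)
  have h0 := hω.ne_zero
  have hlow := validFactor_lowWeights (n := n) t hω
  have hlow' : ∀ i, validFactor ((lowWeights (n := n) t ω)⁻¹ i) := fun i => (hlow i).inv
  have key : mct n = embed Hg t * (K' * (phaseLayer (lowWeights t ω)⁻¹ *
      parityLayer t (lowWeights t ω * Pi.mulSingle t (ω ^ 2)) *
      (mapMat (incFun t) * Matrix.diagonal g) *
      (parityLayer t (lowWeights t ω)⁻¹ * phaseLayer (lowWeights t ω))) * embed Hg t) := by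
    simp only [parityLayer_eq_diagonal, phaseLayer_eq_diagonal, Matrix.diagonal_mul_diagonal]
    rw [diagonal_conj_increment, ← mul_assoc K', hinv, one_mul, mct_eq_mapMat t ht,
      ← hadamard_conj_ctrlSign]
    congr 3
    funext x
    have := layerPhase_incFun t hω' x
    have hN := pow_ne_zero (lowVal t (incFun t x)) h0
    simp only [Function.comp_apply]
    rw [layerPhase_inv _ (incFun t x)]
    simp only [layerPhase_lowWeights]
    rw [← mul_left_inj' hN, ← this]
    field_simp
  have c1 : Nat.card {i : Fin n // lowWeights t ω i ≠ 1} ≤ t :=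
    card_ne_one_le_of_le t fun i hi => by simp [lowWeights, hi.not_gt]
  have c2 : Nat.card {i : Fin n // (lowWeights t ω)⁻¹ i ≠ 1} ≤ t :=
    card_ne_one_le_of_le t fun i hi => by simp [lowWeights, hi.not_gt]
  have c3 : Nat.card {i : Fin n // (lowWeights t ω * Pi.mulSingle t (ω ^ 2) : Fin n → ℂ) i ≠ 1} ≤
      t + 1 :=
    card_ne_one_le_of_le (t + 1) fun i hi => by have := i.2; omega
  have hmid : ∀ i, validFactor ((lowWeights t ω * Pi.mulSingle t (ω ^ 2) : Fin n → ℂ) i) :=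
    fun i => (hlow i).mul (validFactor_mulSingle _ (hω.pow 2) i)
  rw [key]
  have := (hK'.mul ((((Layered.phaseLayer hlow' c2).mul (layered_parityLayer t hmid c3)).mul hK).mul
    ((layered_parityLayer t hlow' c2).mul (Layered.phaseLayer hlow c1)))).mul
    (.clifford (hadamard_mem t))
  convert this.clifford_mul (hadamard_mem t) using 1 <;> ring

/-- For every `n ≥ 6`, the `n`-MCT gate admits a single ancilla-free layered
Clifford+`Z_N` realization `C₀ · P₁ · C₁ ⋯ P_d · C_d` that simultaneously has
phase depth `d ≤ 4n − 6` and phase count (total number of non-identity tensor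
factors over all phase layers) at most `2n² + n − 16`. -/
theorem mct_cliffordZN_depth_and_count :
    ∀ n : ℕ, 6 ≤ n → ∃ d : ℕ, (d : ℤ) ≤ 4 * (n : ℤ) - 6 ∧
      ∃ (C : Fin (d + 1) → Matrix (Fin n → Bool) (Fin n → Bool) ℂ)
        (e : Fin d → Fin n → ℂ),
        (∀ i, C i ∈ Submonoid.closure (cliffordGens n)) ∧
        (∀ j i, validFactor (e j i)) ∧
        ((∑ j : Fin d, Nat.card {i : Fin n // e j i ≠ 1}) : ℤ) ≤ 2 * (n : ℤ) ^ 2 + n - 16 ∧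
        mct n = C 0 * (List.ofFn (fun j : Fin d => phaseLayer (e j) * C j.succ)).prod := by
  intro n hn
  obtain ⟨C, e, hC, he, hc, hM⟩ := (layered_mct (⟨n - 1, by omega⟩ : Fin n)
    (Nat.sub_add_cancel (by omega)) (hasIncrement (n - 1) (by omega) (by omega))).exists_realization
  refine ⟨_, ?_, C, e, hC, he, ?_, hM⟩
  · push_cast
    omega
  · obtain ⟨m, rfl⟩ : ∃ m, n = m + 1 := ⟨n - 1, by omega⟩
    simp only [Nat.add_sub_cancel] at hc
    have h5 : 5 ≤ m ^ 2 := by nlinarith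
    rw [← Nat.cast_sum]
    refine (Int.ofNat_le.mpr hc).trans ?_
    push_cast [Nat.cast_sub h5]
    nlinarith

end MCT
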